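/- arXiv:2412.20333 — 3 statements merged into one kernel-verified Lean document; each statement's English description precedes it below -/
import Mathlib

section
/- Let n ≥ 1 and p, q ∈ ℝⁿ. There exists a future-directed timelike curve γ : [0,1] → ℝⁿ with γ(0) = p and γ(1) = q if and only if q₀ − p₀ > ‖q⃗ − p⃗‖. -/
open Set Metric unitInterval

noncomputable section

/-- `n`-dimensional Minkowski space, modeled as `ℝⁿ` with the Euclidean norm. -/
abbrev Mink (n : ℕ) := EuclideanSpace ℝ (Fin n)

/-- The spatial part `x⃗ = (x 1, …, x (n-1)) ∈ ℝ^{n-1}` of `x ∈ ℝⁿ`. -/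
def spatial {n : ℕ} (x : Mink n) : Mink (n - 1) :=
  (WithLp.equiv 2 _).symm fun i : Fin (n - 1) => x ⟨i.1 + 1, by have := i.isLt; omega⟩

/-- A curve `γ` is future-directed causal if it is `C¹` and
`(γ₀)'(t) ≥ ‖(γ⃗)'(t)‖` for all `t ∈ [0,1]`. -/
def FDCausal {n : ℕ} [NeZero n] (γ : ℝ → Mink n) : Prop :=
  ContDiff ℝ 1 γ ∧
    ∀ t ∈ Set.Icc (0 : ℝ) 1,
      ‖deriv (fun s => spatial (γ s)) t‖ ≤ deriv (fun s => γ s 0) t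

/-- A curve `γ` is past-directed causal if it is `C¹` and
`-(γ₀)'(t) ≥ ‖(γ⃗)'(t)‖` for all `t ∈ [0,1]`. -/
def PDCausal {n : ℕ} [NeZero n] (γ : ℝ → Mink n) : Prop :=
  ContDiff ℝ 1 γ ∧
    ∀ t ∈ Set.Icc (0 : ℝ) 1,
      ‖deriv (fun s => spatial (γ s)) t‖ ≤ -(deriv (fun s => γ s 0) t)

/-- A causal curve is a future- or past-directed causal curve. -/
def IsCausalCurve {n : ℕ} [NeZero n] (γ : ℝ → Mink n) : Prop :=
  FDCausal γ ∨ PDCausal γ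

/-- `S` and `T` are causally disjoint if no causal curve starts in `S` and ends in `T`. -/
def CausallyDisjoint {n : ℕ} [NeZero n] (S T : Set (Mink n)) : Prop :=
  ¬ ∃ γ : ℝ → Mink n, IsCausalCurve γ ∧ γ 0 ∈ S ∧ γ 1 ∈ T

/-- A curve `γ` is future-directed timelike if it is `C¹` and
`(γ₀)'(t) > ‖(γ⃗)'(t)‖` for all `t ∈ [0,1]`. -/
def FDTimelike {n : ℕ} [NeZero n] (γ : ℝ → Mink n) : Prop :=
  ContDiff ℝ 1 γ ∧
    ∀ t ∈ Set.Icc (0 : ℝ) 1,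
      ‖deriv (fun s => spatial (γ s)) t‖ < deriv (fun s => γ s 0) t

/-- The spatial projection as a continuous linear map. -/
def spatialCLM (n : ℕ) : Mink n →L[ℝ] Mink (n - 1) :=
  LinearMap.toContinuousLinearMap
    { toFun := spatial
      map_add' := fun _ _ => rfl
      map_smul' := fun _ _ => rfl }

theorem HasDerivAt.spatial_comp {n : ℕ} {γ : ℝ → Mink n} {v : Mink n} {t : ℝ}
    (h : HasDerivAt γ v t) : HasDerivAt (fun s => spatial (γ s)) (spatial v) t :=
  (spatialCLM n).hasFDerivAt.comp_hasDerivAt t h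

theorem HasDerivAt.coord_comp {n : ℕ} {γ : ℝ → Mink n} {v : Mink n} {t : ℝ}
    (h : HasDerivAt γ v t) (i : Fin n) : HasDerivAt (fun s => γ s i) (v i) t :=
  (EuclideanSpace.proj (𝕜 := ℝ) i).hasFDerivAt.comp_hasDerivAt t h

/-- If the speed of `f` is strictly bounded by the derivative of `τ`, then the displacement of `f`
is strictly bounded by the increment of `τ`. -/
theorem norm_sub_lt_sub_of_norm_deriv_lt {E : Type*} [NormedAddCommGroup E] [NormedSpace ℝ E]
    {f f' : ℝ → E} {τ τ' : ℝ → ℝ} {a b : ℝ} (hab : a < b)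
    (hf : ∀ t ∈ Set.Icc a b, HasDerivAt f (f' t) t)
    (hτ : ∀ t ∈ Set.Icc a b, HasDerivAt τ (τ' t) t)
    (hlt : ∀ t ∈ Set.Icc a b, ‖f' t‖ < τ' t) :
    ‖f b - f a‖ < τ b - τ a := by
  obtain ⟨g, hg, hgv⟩ := exists_dual_vector'' ℝ (f b - f a)
  have hd : ∀ t ∈ Set.Icc a b, HasDerivAt (fun s => τ s - g (f s)) (τ' t - g (f' t)) t :=
    fun t ht => (hτ t ht).sub (g.hasFDerivAt.comp_hasDerivAt t (hf t ht))
  obtain ⟨c, hc, hslope⟩ := exists_hasDerivAt_eq_slope (fun s => τ s - g (f s))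
    (fun t => τ' t - g (f' t)) hab (fun t ht => (hd t ht).continuousAt.continuousWithinAt)
    (fun t ht => hd t (Set.Ioo_subset_Icc_self ht))
  have hpos : 0 < τ' c - g (f' c) := by
    have h₁ : g (f' c) ≤ ‖f' c‖ :=
      (Real.le_norm_self _).trans ((g.le_of_opNorm_le hg _).trans_eq (one_mul _))
    linarith [hlt c (Set.Ioo_subset_Icc_self hc)]
  rw [hslope, div_pos_iff_of_pos_right (sub_pos.2 hab)] at hpos
  have hgv' : g (f b) - g (f a) = ‖f b - f a‖ := by simpa using hgv
  linarith

/-- There is a future-directed timelike curve from `p` to `q` iff `q₀ - p₀ > ‖q⃗ - p⃗‖`. -/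
theorem exists_fdTimelike_iff (n : ℕ) [NeZero n] (hn : 1 ≤ n) (p q : Mink n) :
    (∃ γ : ℝ → Mink n, FDTimelike γ ∧ γ 0 = p ∧ γ 1 = q) ↔
      ‖spatial q - spatial p‖ < q 0 - p 0 := by
  constructor
  · rintro ⟨γ, ⟨hγ, hlt⟩, rfl, rfl⟩
    have hd : ∀ t, HasDerivAt γ (deriv γ t) t :=
      fun t => (hγ.differentiable one_ne_zero t).hasDerivAt
    refine norm_sub_lt_sub_of_norm_deriv_lt (f := fun s => spatial (γ s)) (τ := fun s => γ s 0)
      zero_lt_one (fun t _ => (hd t).spatial_comp) (fun t _ => (hd t).coord_comp 0) fun t ht => ?_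
    simpa only [(hd t).spatial_comp.deriv, ((hd t).coord_comp 0).deriv] using hlt t ht
  · intro h
    have hd : ∀ t, HasDerivAt (fun s : ℝ => p + s • (q - p)) (q - p) t := fun t => by
      simpa using ((hasDerivAt_id t).smul_const (q - p)).const_add p
    refine ⟨fun s => p + s • (q - p), ⟨by fun_prop, fun t _ => ?_⟩, by simp, by simp⟩
    rw [(hd t).spatial_comp.deriv, ((hd t).coord_comp 0).deriv]
    exact h
end
end

section
/- Let n ≥ 1 and S, T ⊆ ℝⁿ. Then S and T are causally disjoint if and only if every pair of points is spacelike separated, i.e. for all p ∈ S and q ∈ T one has |q₀ − p₀| < ‖q⃗ − p⃗‖. -/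
open Set Metric unitInterval

noncomputable section

theorem spatialCLM_apply {n : ℕ} (x : Mink n) : spatialCLM n x = spatial x := rfl

theorem norm_sub_le_sub_of_norm_deriv_le {E : Type*} [NormedAddCommGroup E] [NormedSpace ℝ E]
    {f : ℝ → E} {g : ℝ → ℝ} (hf : Differentiable ℝ f) (hg : Differentiable ℝ g)
    (h : ∀ t ∈ Set.Icc (0 : ℝ) 1, ‖deriv f t‖ ≤ deriv g t) :
    ‖f 1 - f 0‖ ≤ g 1 - g 0 := by
  refine image_norm_le_of_norm_deriv_right_le_deriv_boundary
    (f := fun t => f t - f 0) (f' := deriv f) (B := fun t => g t - g 0) (B' := deriv g)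
    (hf.continuous.sub continuous_const).continuousOn
    (fun t _ => ((hf t).hasDerivAt.sub_const _).hasDerivWithinAt) (by simp)
    (fun t => (hg t).hasDerivAt.sub_const _)
    (fun t ht => h t (Set.Ico_subset_Icc_self ht)) (Set.right_mem_Icc.2 zero_le_one)

theorem differentiable_spatial_comp {n : ℕ} {γ : ℝ → Mink n} (hγ : Differentiable ℝ γ) :
    Differentiable ℝ fun s => spatial (γ s) :=
  (spatialCLM n).differentiable.comp hγ

theorem differentiable_time_comp {n : ℕ} [NeZero n] {γ : ℝ → Mink n}
    (hγ : Differentiable ℝ γ) : Differentiable ℝ fun s => γ s 0 :=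
  (EuclideanSpace.proj (𝕜 := ℝ) (0 : Fin n)).differentiable.comp hγ

theorem FDCausal.norm_spatial_sub_le {n : ℕ} [NeZero n] {γ : ℝ → Mink n} (hγ : FDCausal γ) :
    ‖spatial (γ 1) - spatial (γ 0)‖ ≤ γ 1 0 - γ 0 0 :=
  have hd := hγ.1.differentiable one_ne_zero
  norm_sub_le_sub_of_norm_deriv_le (g := fun s => γ s 0)
    (differentiable_spatial_comp hd) (differentiable_time_comp hd) hγ.2

theorem PDCausal.norm_spatial_sub_le {n : ℕ} [NeZero n] {γ : ℝ → Mink n} (hγ : PDCausal γ) :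
    ‖spatial (γ 1) - spatial (γ 0)‖ ≤ -(γ 1 0 - γ 0 0) := by
  have hd := hγ.1.differentiable one_ne_zero
  have h := norm_sub_le_sub_of_norm_deriv_le (g := fun s => -γ s 0)
    (differentiable_spatial_comp hd) (differentiable_time_comp hd).neg
    (fun t ht => by simpa only [deriv.fun_neg] using hγ.2 t ht)
  linarith

theorem IsCausalCurve.norm_spatial_sub_le {n : ℕ} [NeZero n] {γ : ℝ → Mink n}
    (hγ : IsCausalCurve γ) : ‖spatial (γ 1) - spatial (γ 0)‖ ≤ |γ 1 0 - γ 0 0| :=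
  hγ.elim (fun h => h.norm_spatial_sub_le.trans (le_abs_self _))
    fun h => h.norm_spatial_sub_le.trans (neg_le_abs _)

theorem hasDerivAt_lineMap_spatial {n : ℕ} (p q : Mink n) (t : ℝ) :
    HasDerivAt (fun s => spatial (AffineMap.lineMap p q s)) (spatial q - spatial p) t := by
  have h := (spatialCLM n).hasFDerivAt.comp_hasDerivAt t
    (AffineMap.hasDerivAt_lineMap (a := p) (b := q) (x := t))
  rwa [map_sub] at h

theorem hasDerivAt_lineMap_time {n : ℕ} [NeZero n] (p q : Mink n) (t : ℝ) :
    HasDerivAt (fun s : ℝ => (AffineMap.lineMap p q s : Mink n) 0) (q 0 - p 0) t :=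
  (EuclideanSpace.proj (𝕜 := ℝ) (0 : Fin n)).hasFDerivAt.comp_hasDerivAt t
    (AffineMap.hasDerivAt_lineMap (a := p) (b := q) (x := t))

theorem isCausalCurve_lineMap {n : ℕ} [NeZero n] {p q : Mink n}
    (h : ‖spatial q - spatial p‖ ≤ |q 0 - p 0|) :
    IsCausalCurve fun t : ℝ => (AffineMap.lineMap p q t : Mink n) := by
  have hc : ContDiff ℝ 1 fun t : ℝ => (AffineMap.lineMap p q t : Mink n) := by
    simp only [AffineMap.lineMap_apply_module']
    fun_prop
  refine (le_abs.1 h).imp (fun h => ⟨hc, fun t _ => ?_⟩) fun h => ⟨hc, fun t _ => ?_⟩ <;>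
  rwa [(hasDerivAt_lineMap_spatial p q t).deriv, (hasDerivAt_lineMap_time p q t).deriv]

/-- `S` and `T` are causally disjoint iff every pair of points is spacelike separated. -/
theorem causallyDisjoint_iff_spacelike (n : ℕ) [NeZero n] (hn : 1 ≤ n)
    (S T : Set (Mink n)) :
    CausallyDisjoint S T ↔
      ∀ p ∈ S, ∀ q ∈ T, |q 0 - p 0| < ‖spatial q - spatial p‖ := by
  constructor
  · intro h p hp q hq
    by_contra! hpq
    exact h ⟨_, isCausalCurve_lineMap hpq, by simpa using hp, by simpa using hq⟩
  · rintro h ⟨γ, hγ, h0, h1⟩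
    exact (h _ h0 _ h1).not_ge hγ.norm_spatial_sub_le
end
end

section
/- Fix n ≥ 2 and k ≥ 1. The space CDiam_n(k) of configurations of k causally disjoint rectilinear causal diamonds in the standard diamond and the space CD_n(k) of configurations of k causally disjoint rectilinear discs in the n-dimensional unit disc are homotopy equivalent topological spaces. -/
open Set Metric unitInterval

noncomputable section

/-- The open causal diamond `◊(b, r) = {x : |x₀ - b₀| + ‖x⃗ - b⃗‖ < r}`. -/
def diamond {n : ℕ} [NeZero n] (b : Mink n) (r : ℝ) : Set (Mink n) :=
  {x | |x 0 - b 0| + ‖spatial x - spatial b‖ < r}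

/-- The space `CDiam_n(k)` of `k` causally disjoint rectilinear causal diamonds in the
standard diamond, recorded as tuples of (radius, center). -/
def CDiamSet (n : ℕ) [NeZero n] (k : ℕ) : Set (Fin k → ℝ × Mink n) :=
  {f | (∀ i, 0 < (f i).1 ∧ (f i).1 + |(f i).2 0| + ‖spatial (f i).2‖ ≤ 1) ∧
    ∀ i j, i ≠ j →
      CausallyDisjoint (diamond (f i).2 (f i).1) (diamond (f j).2 (f j).1)}

/-- The space `CD_n(k)` of `k` causally disjoint rectilinear discs in the unit disc,
recorded as tuples of (radius, center). -/
def CDset (n : ℕ) [NeZero n] (k : ℕ) : Set (Fin k → ℝ × Mink n) :=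
  {f | (∀ i, 0 < (f i).1 ∧ (f i).1 + ‖(f i).2‖ ≤ 1) ∧
    ∀ i j, i ≠ j →
      CausallyDisjoint (closedBall (f i).2 (f i).1) (closedBall (f j).2 (f j).1)}

section MinkowskiSpace

variable {n : ℕ}

lemma spatial_smul (c : ℝ) (x : Mink n) : spatial (c • x) = c • spatial x := rfl

lemma spatial_sub (x y : Mink n) : spatial (x - y) = spatial x - spatial y := rfl

lemma closedBall_smul_subset (b : Mink n) (r : ℝ) {c : ℝ} (hc : 0 < c) :
    closedBall (c • b) (c * r) ⊆ (c⁻¹ • ·) ⁻¹' closedBall b r := by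
  intro x hx
  obtain ⟨y, rfl⟩ : ∃ y, c • y = x := ⟨c⁻¹ • x, smul_inv_smul₀ hc.ne' x⟩
  simp only [mem_preimage, inv_smul_smul₀ hc.ne']
  simp only [mem_closedBall, dist_smul₀, Real.norm_of_nonneg hc.le] at hx ⊢
  exact le_of_mul_le_mul_left hx hc

variable [NeZero n]

lemma norm_sq_eq_time_add_spatial (x : Mink n) : ‖x‖ ^ 2 = |x 0| ^ 2 + ‖spatial x‖ ^ 2 := by
  obtain ⟨m, rfl⟩ := Nat.exists_eq_succ_of_ne_zero (NeZero.ne n)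
  rw [EuclideanSpace.norm_sq_eq, EuclideanSpace.norm_sq_eq, Fin.sum_univ_succ]
  rfl

lemma abs_time_le_norm (x : Mink n) : |x 0| ≤ ‖x‖ := by
  refine abs_le_of_sq_le_sq' ?_ (norm_nonneg x) |>.2
  nlinarith [norm_sq_eq_time_add_spatial x, sq_nonneg ‖spatial x‖]

lemma norm_spatial_le_norm (x : Mink n) : ‖spatial x‖ ≤ ‖x‖ := by
  refine abs_le_of_sq_le_sq' ?_ (norm_nonneg x) |>.2
  nlinarith [norm_sq_eq_time_add_spatial x, sq_nonneg |x 0|]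

lemma norm_le_abs_time_add_norm_spatial (x : Mink n) : ‖x‖ ≤ |x 0| + ‖spatial x‖ := by
  refine abs_le_of_sq_le_sq' ?_ (by positivity) |>.2
  nlinarith [norm_sq_eq_time_add_spatial x, mul_nonneg (abs_nonneg (x 0)) (norm_nonneg (spatial x))]

end MinkowskiSpace

section Causal

variable {n : ℕ} [NeZero n]

lemma IsCausalCurve.smul {γ : ℝ → Mink n} (hγ : IsCausalCurve γ) {c : ℝ} (hc : 0 ≤ c) :
    IsCausalCurve (fun t => c • γ t) := by
  have hs (t : ℝ) : ‖deriv (fun s => spatial (c • γ s)) t‖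
      = c * ‖deriv (fun s => spatial (γ s)) t‖ := by
    simp only [spatial_smul, deriv_fun_const_smul_field, norm_smul, Real.norm_of_nonneg hc]
  have ht (t : ℝ) : deriv (fun s => (c • γ s) 0) t = c * deriv (fun s => γ s 0) t := by
    simp only [PiLp.smul_apply, smul_eq_mul, deriv_const_mul_field]
  refine hγ.imp (fun h => ⟨h.1.const_smul c, fun t htI => ?_⟩)
    (fun h => ⟨h.1.const_smul c, fun t htI => ?_⟩)
  · rw [hs, ht]
    exact mul_le_mul_of_nonneg_left (h.2 t htI) hc
  · rw [hs, ht, ← mul_neg]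
    exact mul_le_mul_of_nonneg_left (h.2 t htI) hc

lemma CausallyDisjoint.mono {S S' T T' : Set (Mink n)} (h : CausallyDisjoint S T)
    (hS : S' ⊆ S) (hT : T' ⊆ T) : CausallyDisjoint S' T' :=
  fun ⟨γ, hγ, h0, h1⟩ => h ⟨γ, hγ, hS h0, hT h1⟩

/-- Causal disjointness is invariant under homotheties. -/
lemma CausallyDisjoint.preimage_smul {S T : Set (Mink n)} (h : CausallyDisjoint S T) {c : ℝ}
    (hc : 0 ≤ c) : CausallyDisjoint ((c • ·) ⁻¹' S) ((c • ·) ⁻¹' T) :=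
  fun ⟨γ, hγ, h0, h1⟩ => h ⟨fun t => c • γ t, hγ.smul hc, h0, h1⟩

lemma diamond_subset_diamond (b : Mink n) {r s : ℝ} (h : r ≤ s) : diamond b r ⊆ diamond b s :=
  fun _ hx => lt_of_lt_of_le hx h

lemma diamond_subset_closedBall (b : Mink n) (r : ℝ) : diamond b r ⊆ closedBall b r := by
  intro x hx
  rw [mem_closedBall, dist_eq_norm]
  exact (norm_le_abs_time_add_norm_spatial (x - b)).trans (le_of_lt hx)

lemma closedBall_subset_diamond (b : Mink n) {r s : ℝ} (h : 2 * r < s) :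
    closedBall b r ⊆ diamond b s := by
  intro x hx
  rw [mem_closedBall, dist_eq_norm] at hx
  have h0 : |x 0 - b 0| ≤ ‖x - b‖ := abs_time_le_norm (x - b)
  have h1 : ‖spatial x - spatial b‖ ≤ ‖x - b‖ := norm_spatial_le_norm (x - b)
  change |x 0 - b 0| + ‖spatial x - spatial b‖ < s
  linarith

lemma diamond_smul_subset (b : Mink n) (r : ℝ) {c : ℝ} (hc : 0 < c) :
    diamond (c • b) (c * r) ⊆ (c⁻¹ • ·) ⁻¹' diamond b r := by
  intro x hx
  obtain ⟨y, rfl⟩ : ∃ y, c • y = x := ⟨c⁻¹ • x, smul_inv_smul₀ hc.ne' x⟩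
  simp only [mem_preimage, inv_smul_smul₀ hc.ne']
  simp only [diamond, mem_ofPred_eq, spatial_smul, PiLp.smul_apply, smul_eq_mul, ← mul_sub,
    ← smul_sub, abs_mul, norm_smul, Real.norm_eq_abs, abs_of_pos hc, ← mul_add] at hx ⊢
  exact lt_of_mul_lt_mul_left hx hc.le

end Causal

section Rescale

variable {n k : ℕ}

/-- Multiply all radii of a configuration by `α` and all centers by `β`. -/
def rescale (α β : ℝ) (f : Fin k → ℝ × Mink n) : Fin k → ℝ × Mink n :=
  fun i => (α * (f i).1, β • (f i).2)

lemma rescale_one_one (f : Fin k → ℝ × Mink n) : rescale 1 1 f = f :=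
  funext fun i => by simp [rescale]

lemma rescale_rescale (α β α' β' : ℝ) (f : Fin k → ℝ × Mink n) :
    rescale α β (rescale α' β' f) = rescale (α * α') (β * β') f :=
  funext fun i => by simp [rescale, mul_assoc, mul_smul]

lemma Continuous.rescale {X : Type*} [TopologicalSpace X] {α β : X → ℝ}
    {f : X → Fin k → ℝ × Mink n} (hα : Continuous α) (hβ : Continuous β) (hf : Continuous f) :
    Continuous fun x => rescale (α x) (β x) (f x) :=
  continuous_pi fun i => (hα.mul ((continuous_apply i).comp hf).fst).prodMk
    (hβ.smul ((continuous_apply i).comp hf).snd)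

variable [NeZero n]

lemma rescale_mem_CDiamSet {α β : ℝ} (hα : 0 < α) (hαβ : α ≤ β) (hβ : β ≤ 1)
    {f : Fin k → ℝ × Mink n} (hf : f ∈ CDiamSet n k) : rescale α β f ∈ CDiamSet n k := by
  have hβ0 : 0 < β := hα.trans_le hαβ
  refine ⟨fun i => ⟨mul_pos hα (hf.1 i).1, ?_⟩, fun i j hij => ?_⟩
  · obtain ⟨h0, h1⟩ := hf.1 i
    simp only [rescale, spatial_smul, PiLp.smul_apply, smul_eq_mul, abs_mul, norm_smul,
      Real.norm_eq_abs, abs_of_pos hβ0]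
    nlinarith [mul_le_mul_of_nonneg_right hαβ h0.le]
  · have key (i : Fin k) : diamond (rescale α β f i).2 (rescale α β f i).1 ⊆
        (β⁻¹ • ·) ⁻¹' diamond (f i).2 (f i).1 :=
      (diamond_subset_diamond _ (mul_le_mul_of_nonneg_right hαβ (hf.1 i).1.le)).trans
        (diamond_smul_subset _ _ hβ0)
    exact ((hf.2 i j hij).preimage_smul (inv_nonneg.2 hβ0.le)).mono (key i) (key j)

lemma rescale_mem_CDset {α β : ℝ} (hα : 0 < α) (hαβ : α ≤ β) (hβ : β ≤ 1)
    {f : Fin k → ℝ × Mink n} (hf : f ∈ CDset n k) : rescale α β f ∈ CDset n k := by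
  have hβ0 : 0 < β := hα.trans_le hαβ
  refine ⟨fun i => ⟨mul_pos hα (hf.1 i).1, ?_⟩, fun i j hij => ?_⟩
  · obtain ⟨h0, h1⟩ := hf.1 i
    simp only [rescale, norm_smul, Real.norm_eq_abs, abs_of_pos hβ0]
    nlinarith [mul_le_mul_of_nonneg_right hαβ h0.le]
  · have key (i : Fin k) : closedBall (rescale α β f i).2 (rescale α β f i).1 ⊆
        (β⁻¹ • ·) ⁻¹' closedBall (f i).2 (f i).1 :=
      (closedBall_subset_closedBall (mul_le_mul_of_nonneg_right hαβ (hf.1 i).1.le)).trans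
        (closedBall_smul_subset _ _ hβ0)
    exact ((hf.2 i j hij).preimage_smul (inv_nonneg.2 hβ0.le)).mono (key i) (key j)

/-- Replace each diamond by a concentric disc of a third of its radius. -/
lemma rescale_mem_CDset_of_mem_CDiamSet {f : Fin k → ℝ × Mink n} (hf : f ∈ CDiamSet n k) :
    rescale (1 / 3) 1 f ∈ CDset n k := by
  refine ⟨fun i => ⟨mul_pos (by norm_num) (hf.1 i).1, ?_⟩, fun i j hij => ?_⟩
  · obtain ⟨h0, h1⟩ := hf.1 i
    simp only [rescale, one_smul]
    linarith [norm_le_abs_time_add_norm_spatial (f i).2]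
  · have key (i : Fin k) : closedBall (rescale (1 / 3) 1 f i).2 (rescale (1 / 3) 1 f i).1 ⊆
        diamond (f i).2 (f i).1 := by
      simp only [rescale, one_smul]
      exact closedBall_subset_diamond _ (by linarith [(hf.1 i).1])
    exact (hf.2 i j hij).mono (key i) (key j)

/-- Replace each disc by the diamond inscribed in it, and shrink the configuration by half. -/
lemma rescale_mem_CDiamSet_of_mem_CDset {f : Fin k → ℝ × Mink n} (hf : f ∈ CDset n k) :
    rescale (1 / 2) (1 / 2) f ∈ CDiamSet n k := by
  refine ⟨fun i => ⟨mul_pos (by norm_num) (hf.1 i).1, ?_⟩, fun i j hij => ?_⟩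
  · obtain ⟨h0, h1⟩ := hf.1 i
    simp only [rescale, spatial_smul, PiLp.smul_apply, smul_eq_mul, abs_mul, norm_smul,
      Real.norm_eq_abs, abs_of_pos (one_half_pos (α := ℝ))]
    linarith [abs_time_le_norm (f i).2, norm_spatial_le_norm (f i).2]
  · exact ((rescale_mem_CDset one_half_pos le_rfl (by norm_num) hf).2 i j hij).mono
      (diamond_subset_closedBall _ _) (diamond_subset_closedBall _ _)

end Rescale

/-- A self-map of a space of configurations that is given by a rescaling with factors `α ≤ β` is
homotopic to the identity as soon as the space is stable under such rescalings. -/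
lemma homotopic_id_of_eq_rescale {n k : ℕ} {A : Set (Fin k → ℝ × Mink n)}
    (hA : ∀ α β : ℝ, 0 < α → α ≤ β → β ≤ 1 → ∀ f ∈ A, rescale α β f ∈ A)
    {α β : ℝ} (hα : 0 < α) (hαβ : α ≤ β) (hβ : β ≤ 1) {g : C(A, A)}
    (hg : ∀ f, (g f : Fin k → ℝ × Mink n) = rescale α β f) :
    g.Homotopic (ContinuousMap.id A) := by
  refine ContinuousMap.Homotopic.symm ⟨{
    toFun := fun p => ⟨rescale (1 - p.1 * (1 - α)) (1 - p.1 * (1 - β)) p.2,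
      hA _ _ ?_ ?_ ?_ _ p.2.2⟩
    continuous_toFun := Continuous.subtype_mk
      (Continuous.rescale (by fun_prop) (by fun_prop) (by fun_prop)) _
    map_zero_left := fun f => Subtype.ext ?_
    map_one_left := fun f => Subtype.ext ?_ }⟩
  · nlinarith [p.1.2.1, p.1.2.2]
  · nlinarith [p.1.2.1, p.1.2.2]
  · nlinarith [p.1.2.1, p.1.2.2]
  · simp [rescale_one_one]
  · simp [hg]

/-- The spaces `CDiam_n(k)` and `CD_n(k)` are homotopy equivalent. -/
theorem cdiam_homotopyEquiv_cd (n k : ℕ) [NeZero n] (hn : 2 ≤ n) (hk : 1 ≤ k) :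
    Nonempty (ContinuousMap.HomotopyEquiv (CDiamSet n k) (CDset n k)) := by
  let F : C(CDiamSet n k, CDset n k) :=
    ⟨fun f => ⟨rescale (1 / 3) 1 f, rescale_mem_CDset_of_mem_CDiamSet f.2⟩,
      (continuous_const.rescale continuous_const continuous_subtype_val).subtype_mk _⟩
  let G : C(CDset n k, CDiamSet n k) :=
    ⟨fun f => ⟨rescale (1 / 2) (1 / 2) f, rescale_mem_CDiamSet_of_mem_CDset f.2⟩,
      (continuous_const.rescale continuous_const continuous_subtype_val).subtype_mk _⟩
  refine ⟨⟨F, G, ?_, ?_⟩⟩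
  · exact homotopic_id_of_eq_rescale (fun _ _ h0 h1 h2 _ => rescale_mem_CDiamSet h0 h1 h2)
      (by norm_num) (by norm_num) (by norm_num) fun f => rescale_rescale (1 / 2) (1 / 2) (1 / 3) 1 _
  · exact homotopic_id_of_eq_rescale (fun _ _ h0 h1 h2 _ => rescale_mem_CDset h0 h1 h2)
      (by norm_num) (by norm_num) (by norm_num) fun f => rescale_rescale (1 / 3) 1 (1 / 2) (1 / 2) _
end
end
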